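/- arXiv:1406.2108 — 2 statements merged into one kernel-verified Lean document; each statement's English description precedes it below -/
import Mathlib

section
/- Let q be a prime power, 0 < ε < 1, and d, n positive integers with n > q, n > d, and q > 4(d+1)/ε. Then there exists a (1−ε)-dense hitting set A for H_d over F_q of size at most m = ⌈(d+1)·log(q(n+1)) / (ε·log(εq/(e(d+1))))⌉. -/
open Finset in
/-- Functions that agree with `g` in at least `t` places: a union bound over the `t`-subsets. -/
theorem card_filter_le_card_agree {F : Type*} [Fintype F] [DecidableEq F] {m t : ℕ}
    (g : Fin m → F) :
    #{c : Fin m → F | t ≤ #{r | c r = g r}} ≤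
      m.choose t * Fintype.card F ^ (m - t) := by
  have hsub : ({c : Fin m → F | t ≤ #{r | c r = g r}} : Finset (Fin m → F)) ⊆
      (powersetCard t univ).biUnion fun T =>
        Fintype.piFinset fun r => if r ∈ T then {g r} else univ := by
    intro c hc
    obtain ⟨T, hT, hTt⟩ := exists_subset_card_eq (mem_filter.1 hc).2
    refine mem_biUnion.2 ⟨T, mem_powersetCard.2 ⟨subset_univ _, hTt⟩, ?_⟩
    refine Fintype.mem_piFinset.2 fun r => ?_
    split_ifs with hr
    · exact mem_singleton.2 (mem_filter.1 (hT hr)).2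
    · exact mem_univ _
  refine (card_le_card hsub).trans ((card_biUnion_le_card_mul _ _ (Fintype.card F ^ (m - t))
    fun T hT => ?_).trans ?_)
  · rw [Fintype.card_piFinset]
    have hcard : ∀ r, #(if r ∈ T then {g r} else (univ : Finset F)) =
        if r ∈ T then 1 else Fintype.card F := by
      intro r; split_ifs <;> simp
    simp only [hcard]
    rw [prod_ite, prod_const_one, one_mul, prod_const, filter_not, filter_mem_eq_inter,
      univ_inter, ← compl_eq_univ_sdiff, card_compl, (mem_powersetCard.1 hT).2, Fintype.card_fin]
  · simp

open Finset in
/-- The functions that take equal values at two distinct points. -/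
theorem card_filter_apply_eq {F : Type*} [Fintype F] [DecidableEq F] {m : ℕ} {i j : Fin m}
    (hij : i ≠ j) :
    #{c : Fin m → F | c i = c j} * Fintype.card F = Fintype.card F ^ m := by
  have h : #(({c | c i = c j} : Finset (Fin m → F)) ×ˢ (univ : Finset F)) =
      #(univ : Finset (Fin m → F)) := by
    refine card_bij' (fun x _ => Function.update x.1 i x.2)
      (fun (c : Fin m → F) _ => (Function.update c i (c j), c i)) ?_ ?_ ?_ ?_
    · simp
    · intro c _
      simp [Function.update_of_ne hij.symm]
    · rintro ⟨c, x⟩ hc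
      have hc' : c i = c j := by simpa using hc
      simp [Function.update_of_ne hij.symm, ← hc']
    · intro c _
      simp
  simpa [card_product] using h

open Finset in
/-- Averaging: outside a set of density at most `1 / q` some function separates all but a
`1 / (q - 1)` fraction of a given family of pairs of distinct points. -/
theorem exists_notMem_card_filter_mul_le {F : Type*} [Fintype F] [DecidableEq F]
    {m : ℕ} (S : Finset (Fin m × Fin m)) (hS : ∀ p ∈ S, p.1 ≠ p.2) (B : Finset (Fin m → F))
    (hq : 2 ≤ Fintype.card F) (hB : #B * Fintype.card F ≤ Fintype.card F ^ m) :
    ∃ c ∉ B, #{p ∈ S | c p.1 = c p.2} * (Fintype.card F - 1) ≤ #S := by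
  by_contra! hcon
  set q := Fintype.card F
  have hsum : (∑ c : Fin m → F, #{p ∈ S | c p.1 = c p.2}) * q = #S * q ^ m := by
    simp only [card_filter]
    rw [sum_comm, sum_mul, card_eq_sum_ones, sum_mul]
    refine sum_congr rfl fun p hp => ?_
    rw [← card_filter, card_filter_apply_eq (hS p hp), one_mul]
  have hle : ∑ c ∈ Bᶜ, #{p ∈ S | c p.1 = c p.2} ≤ ∑ c : Fin m → F, #{p ∈ S | c p.1 = c p.2} :=
    sum_le_sum_of_subset (subset_univ _)
  have hlow : #Bᶜ * (#S + 1) ≤ (∑ c ∈ Bᶜ, #{p ∈ S | c p.1 = c p.2}) * (q - 1) := by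
    rw [sum_mul, ← smul_eq_mul]
    exact card_nsmul_le_sum _ _ _ fun c hc => hcon c (mem_compl.1 hc)
  have hcompl : #B + #Bᶜ = q ^ m := by
    rw [card_add_card_compl]; simp [q]
  obtain ⟨k, hk⟩ : ∃ k, q = k + 2 := ⟨q - 2, by omega⟩
  have hpos : 0 < q ^ m := Nat.pow_pos (by omega)
  have hkq : q - 1 = k + 1 := by omega
  rw [hkq] at hlow
  have h1 : #Bᶜ * (#S + 1) * q ≤ #S * q ^ m * (k + 1) := by
    calc #Bᶜ * (#S + 1) * q
          ≤ (∑ c : Fin m → F, #{p ∈ S | c p.1 = c p.2}) * (k + 1) * q := by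
          gcongr ?_ * q
          exact hlow.trans (by gcongr)
      _ = _ := by rw [← hsum]; ring
  have h2 : q ^ m * (k + 1) ≤ #Bᶜ * q := by
    have : q ^ m * q = #B * q + #Bᶜ * q := by rw [← hcompl]; ring
    rw [hk] at this hB ⊢
    nlinarith
  nlinarith [Nat.mul_le_mul_left (#S + 1) h2, Nat.mul_pos hpos k.succ_pos]

open Finset in
/-- Greedy choice of `k` columns with pairwise agreement below `t` and few coinciding rows. -/
theorem exists_columns {F : Type*} [Fintype F] [DecidableEq F] {m t N : ℕ}
    (hq : 2 ≤ Fintype.card F) (htm : t ≤ m)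
    (hN : m.choose t * (Fintype.card F * N) ≤ Fintype.card F ^ t) (k : ℕ) (hk : k ≤ N) :
    ∃ c : Fin k → Fin m → F, (∀ i j, i ≠ j → #{r | c i r = c j r} < t) ∧
      #{p : Fin m × Fin m | p.1 ≠ p.2 ∧ ∀ i, c i p.1 = c i p.2} * (Fintype.card F - 1) ^ k
        ≤ m ^ 2 := by
  induction k with
  | zero =>
    refine ⟨fun i => i.elim0, fun i => i.elim0, ?_⟩
    rw [pow_zero, mul_one]
    refine (card_le_univ _).trans ?_
    simp [sq]
  | succ k ih =>
    obtain ⟨c, hc, hcol⟩ := ih (by omega)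
    obtain ⟨x, hxB, hx⟩ := exists_notMem_card_filter_mul_le
      {p : Fin m × Fin m | p.1 ≠ p.2 ∧ ∀ i, c i p.1 = c i p.2} (fun p hp => (mem_filter.1 hp).2.1)
      (univ.biUnion fun i : Fin k => {x : Fin m → F | t ≤ #{r | x r = c i r}}) hq (by
        calc _ ≤ (k * (m.choose t * Fintype.card F ^ (m - t))) * Fintype.card F := by
              gcongr
              refine (card_biUnion_le_card_mul _ _ _
                fun i _ => card_filter_le_card_agree (c i)).trans ?_
              simp
          _ ≤ (N * (m.choose t * Fintype.card F ^ (m - t))) * Fintype.card F := by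
              gcongr; omega
          _ = (m.choose t * (Fintype.card F * N)) * Fintype.card F ^ (m - t) := by ring
          _ ≤ Fintype.card F ^ t * Fintype.card F ^ (m - t) := by gcongr
          _ = _ := by rw [← pow_add, Nat.add_sub_cancel' htm])
    have hxc : ∀ i, #{r | x r = c i r} < t := by simpa using hxB
    refine ⟨Fin.cons x c, ?_, ?_⟩
    · intro i j hij
      induction i using Fin.cases with
      | zero =>
        induction j using Fin.cases with
        | zero => exact absurd rfl hij
        | succ j => simpa using hxc j
      | succ i =>
        induction j using Fin.cases with
        | zero => simpa [eq_comm] using hxc i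
        | succ j => simpa using hc i j (fun h => hij (by rw [h]))
    · rw [filter_filter] at hx
      have heq : #{p : Fin m × Fin m | p.1 ≠ p.2 ∧ ∀ i : Fin (k + 1),
          (Fin.cons x c : Fin (k + 1) → Fin m → F) i p.1 =
            (Fin.cons x c : Fin (k + 1) → Fin m → F) i p.2} =
          #{p : Fin m × Fin m | (p.1 ≠ p.2 ∧ ∀ i, c i p.1 = c i p.2) ∧ x p.1 = x p.2} := by
        refine congrArg card (filter_congr fun p _ => ?_)
        simp only [Fin.forall_fin_succ, Fin.cons_zero, Fin.cons_succ]
        tauto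
      rw [heq, pow_succ']
      calc _ = _ := (mul_assoc _ _ _).symm
        _ ≤ _ := Nat.mul_le_mul_right _ hx
        _ ≤ _ := hcol

/-- If `w > 1` bounds `t q / (e m)` from below and `w ^ s ≥ K` with `s ≤ t`, then
`C(m, t) K ≤ q ^ t`. -/
theorem choose_mul_le_pow {m t q : ℕ} {w K s : ℝ} (hm : 0 < m) (hw : 1 ≤ w)
    (hwt : w * (Real.exp 1 * m) ≤ t * q) (hst : s ≤ t) (hK : K ≤ w ^ s) :
    (m.choose t : ℝ) * K ≤ (q : ℝ) ^ t := by
  have hm' : (0 : ℝ) < m := by exact_mod_cast hm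
  have hKt : K ≤ w ^ t :=
    hK.trans (by rw [← Real.rpow_natCast]; exact Real.rpow_le_rpow_of_exponent_le hw hst)
  have hfac : (0 : ℝ) < t.factorial := by exact_mod_cast t.factorial_pos
  have hexp : (t : ℝ) ^ t ≤ Real.exp 1 ^ t * t.factorial := by
    have := Real.pow_div_factorial_le_exp (t : ℝ) (Nat.cast_nonneg _) t
    rw [div_le_iff₀ hfac] at this
    rwa [← Real.exp_nat_mul, mul_one]
  have hchoose : (m.choose t : ℝ) * t.factorial ≤ (m : ℝ) ^ t := by
    rw [← le_div_iff₀ hfac]; exact Nat.choose_le_pow_div t m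
  have hpow : w ^ t * (Real.exp 1 ^ t * (m : ℝ) ^ t) ≤ (t : ℝ) ^ t * (q : ℝ) ^ t := by
    rw [← mul_pow, ← mul_pow, ← mul_pow]
    exact pow_le_pow_left₀ (by positivity) hwt t
  have hpos : 0 < Real.exp 1 ^ t * (t.factorial : ℝ) := by positivity
  refine le_of_mul_le_mul_right ?_ hpos
  calc (m.choose t : ℝ) * K * (Real.exp 1 ^ t * t.factorial)
      ≤ (m.choose t : ℝ) * w ^ t * (Real.exp 1 ^ t * t.factorial) := by gcongr
    _ = (m.choose t * t.factorial : ℝ) * (w ^ t * Real.exp 1 ^ t) := by ring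
    _ ≤ (m : ℝ) ^ t * (w ^ t * Real.exp 1 ^ t) := by gcongr
    _ = w ^ t * (Real.exp 1 ^ t * (m : ℝ) ^ t) := by ring
    _ ≤ (t : ℝ) ^ t * (q : ℝ) ^ t := hpow
    _ ≤ (Real.exp 1 ^ t * t.factorial) * (q : ℝ) ^ t := by gcongr
    _ = _ := by ring

theorem two_mul_sq_sq_lt_eight_pow {n : ℕ} (hn : 10 ≤ n) : (2 * n ^ 2) ^ 2 < 8 ^ n := by
  induction n, hn using Nat.le_induction with
  | base => norm_num
  | succ n hn ih =>
    have h : 2 * (n + 1) ^ 2 ≤ 2 * (2 * n ^ 2) := by nlinarith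
    calc (2 * (n + 1) ^ 2) ^ 2 ≤ (2 * (2 * n ^ 2)) ^ 2 := Nat.pow_le_pow_left h 2
      _ = 4 * (2 * n ^ 2) ^ 2 := by ring
      _ < 8 ^ (n + 1) := by rw [pow_succ 8]; linarith [Nat.zero_le ((2 * n ^ 2) ^ 2)]

open Finset in
/-- The rows of a matrix with distinct rows whose columns pairwise agree in fewer than `t` places
form a dense hitting set. -/
theorem exists_dense_of_columns {F : Type*} [DecidableEq F] {m n d t : ℕ} {ε : ℝ}
    (c : Fin n → Fin m → F) (hc : ∀ i j, i ≠ j → #{r | c i r = c j r} < t)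
    (hinj : ∀ r s, r ≠ s → ∃ i, c i r ≠ c i s) (hm : 0 < m) (hdt : (d : ℝ) * (t - 1 : ℕ) < ε * m) :
    ∃ A : Finset (Fin n → F), A.Nonempty ∧ A.card = m ∧
      ∀ I : Finset (Fin n × Fin n), I.card ≤ d → (∀ p ∈ I, p.1 ≠ p.2) →
        (1 - ε) * A.card < ((A.filter fun a => ∀ p ∈ I, a p.1 ≠ a p.2).card : ℝ) := by
  have hrow : Function.Injective fun (r : Fin m) (i : Fin n) => c i r := by
    intro r s hrs
    by_contra hne
    obtain ⟨i, hi⟩ := hinj r s hne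
    exact hi (congrFun hrs i)
  have hcard : (univ.image fun (r : Fin m) (i : Fin n) => c i r).card = m := by
    rw [card_image_of_injective _ hrow, card_univ, Fintype.card_fin]
  refine ⟨univ.image fun r i => c i r, card_pos.1 (by rwa [hcard]), hcard, fun I hI hne => ?_⟩
  rw [hcard, filter_image, card_image_of_injective _ hrow]
  have hbad : #{r : Fin m | ¬ ∀ p ∈ I, c p.1 r ≠ c p.2 r} ≤ d * (t - 1) := by
    have hsub : ({r : Fin m | ¬ ∀ p ∈ I, c p.1 r ≠ c p.2 r} : Finset (Fin m)) ⊆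
        I.biUnion fun p => {r | c p.1 r = c p.2 r} := by
      intro r hr
      simpa using hr
    refine (card_le_card hsub).trans ((card_biUnion_le_card_mul _ _ (t - 1) fun p hp =>
      Nat.le_sub_one_of_lt (hc _ _ (hne p hp))).trans ?_)
    gcongr
  have hsum := card_filter_add_card_filter_not (s := (univ : Finset (Fin m)))
    (fun r => ∀ p ∈ I, c p.1 r ≠ c p.2 r)
  rw [card_univ, Fintype.card_fin] at hsum
  have hsum' : (#{r : Fin m | ∀ p ∈ I, c p.1 r ≠ c p.2 r} : ℝ) +
      #{r : Fin m | ¬ ∀ p ∈ I, c p.1 r ≠ c p.2 r} = m := by exact_mod_cast hsum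
  have hbad' : (#{r : Fin m | ¬ ∀ p ∈ I, c p.1 r ≠ c p.2 r} : ℝ) ≤ d * (t - 1 : ℕ) := by
    exact_mod_cast hbad
  linarith

/-- Let `q` be a prime power, `0 < ε < 1`, and `d, n` positive integers with `n > q`,
`n > d` and `q > 4(d+1)/ε`.  Then there exists a `(1−ε)`-dense hitting set `A` for
`H_d` over `F_q` of size at most `⌈(d+1)·log(q(n+1)) / (ε·log(εq/(e(d+1))))⌉`:
a finite nonempty set `A ⊆ F_q^n` such that for every `I ⊆ [n]×[n]` with `|I| ≤ d` and
`i₁ ≠ i₂` for every `(i₁,i₂) ∈ I`, the fraction of `a ∈ A` with `a_{i₁} ≠ a_{i₂}` for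
all `(i₁,i₂) ∈ I` is greater than `1 − ε`. -/
theorem exists_dense_hitting_set_large_q (q d n : ℕ) (hq : IsPrimePow q) (ε : ℝ)
    (hε0 : 0 < ε) (hε1 : ε < 1)
    (hd : 0 < d) (hn : 0 < n) (hnq : n > q) (hnd : n > d)
    (hqd : (q : ℝ) > 4 * ((d : ℝ) + 1) / ε)
    (F : Type) [Field F] [Fintype F] [DecidableEq F] (hF : Fintype.card F = q) :
    ∃ A : Finset (Fin n → F),
      A.Nonempty ∧
      A.card ≤
        ⌈((d : ℝ) + 1) * Real.log (q * (n + 1)) /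
          (ε * Real.log (ε * q / (Real.exp 1 * ((d : ℝ) + 1))))⌉₊ ∧
      ∀ I : Finset (Fin n × Fin n), I.card ≤ d → (∀ p ∈ I, p.1 ≠ p.2) →
        (1 - ε) * A.card < ((A.filter fun a => ∀ p ∈ I, a p.1 ≠ a p.2).card : ℝ) := by
  have hd1 : (0 : ℝ) < (d : ℝ) + 1 := by positivity
  have hd' : (1 : ℝ) ≤ d := by exact_mod_cast hd
  have hqε : 4 * ((d : ℝ) + 1) < ε * q := by
    rw [gt_iff_lt, div_lt_iff₀ hε0] at hqd; linarith
  have hq0 : (0 : ℝ) < q := by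
    have : 0 < 4 * ((d : ℝ) + 1) / ε := by positivity
    linarith
  have hq8 : 8 < q := by
    have : (8 : ℝ) < q := by nlinarith
    exact_mod_cast this
  have hn10 : 10 ≤ n := by omega
  have hn10' : (10 : ℝ) ≤ n := by exact_mod_cast hn10
  have hqn' : (q : ℝ) ≤ n := by exact_mod_cast hnq.le
  set w : ℝ := ε * q / (Real.exp 1 * ((d : ℝ) + 1)) with hw
  set K : ℝ := (q : ℝ) * (n + 1) with hK
  have hw4 : 4 / Real.exp 1 ≤ w := by
    rw [hw, div_le_div_iff₀ (Real.exp_pos 1) (by positivity)]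
    nlinarith [Real.exp_pos 1]
  have hw0 : 0 < w := by positivity
  have hL : (0.386 : ℝ) < Real.log w := by
    have h4 : Real.log (4 / Real.exp 1) = 2 * Real.log 2 - 1 := by
      rw [Real.log_div (by norm_num) (Real.exp_pos 1).ne', Real.log_exp,
        show (4 : ℝ) = 2 ^ 2 by norm_num, Real.log_pow]
      norm_num
    have := Real.log_le_log (by positivity) hw4
    linarith [Real.log_two_gt_d9]
  have hw1 : 1 ≤ w := by
    by_contra! h
    linarith [Real.log_nonpos hw0.le h.le]
  have hK0 : 0 < K := by positivity
  have hlogK : Real.log K ≤ 2 * n := by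
    rw [hK, Real.log_mul hq0.ne' (by positivity)]
    linarith [Real.log_le_sub_one_of_pos hq0,
      Real.log_le_sub_one_of_pos (show (0 : ℝ) < n + 1 by positivity)]
  have hlogK0 : 0 < Real.log K := Real.log_pos (by
    nlinarith [show (8 : ℝ) < q by exact_mod_cast hq8])
  set X : ℝ := ((d : ℝ) + 1) * Real.log K / (ε * Real.log w) with hX
  have hεL : 0 < ε * Real.log w := by positivity
  have hX0 : 0 < X := by positivity
  set m := ⌈X⌉₊ with hmdef
  have hm0 : 0 < m := Nat.ceil_pos.2 hX0
  have hm0' : (0 : ℝ) < m := by exact_mod_cast hm0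
  have hXm : X ≤ m := Nat.le_ceil X
  have hmle : m ≤ 2 * n ^ 2 := by
    have hX2 : X ≤ 2 * (n : ℝ) ^ 2 := by
      rw [hX, div_le_iff₀ hεL]
      calc ((d : ℝ) + 1) * Real.log K ≤ (ε * q / 4) * (2 * n) := by gcongr; linarith
        _ ≤ (ε * n / 4) * (2 * n) := by gcongr
        _ = 2 * (n : ℝ) ^ 2 * (ε * 0.25) := by ring
        _ ≤ _ := by gcongr; linarith
    exact Nat.ceil_le.2 (by exact_mod_cast hX2)
  set s : ℝ := ε * m / ((d : ℝ) + 1) with hs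
  have hs0 : 0 < s := by positivity
  set t := ⌈s⌉₊ with ht
  have hst : s ≤ t := Nat.le_ceil s
  have htm : t ≤ m := by
    refine Nat.ceil_le.2 ?_
    rw [hs, div_le_iff₀ hd1]
    nlinarith
  have ht0 : 0 < t := Nat.ceil_pos.2 hs0
  have hKw : K ≤ w ^ s := by
    rw [Real.rpow_def_of_pos hw0, ← Real.log_le_iff_le_exp hK0, hs, ← mul_div_assoc,
      le_div_iff₀ hd1]
    rw [hX, div_le_iff₀ hεL] at hXm
    linarith
  have hwt : w * (Real.exp 1 * m) ≤ t * q := by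
    calc w * (Real.exp 1 * m) = s * q := by rw [hw, hs]; field_simp
      _ ≤ _ := by gcongr
  have hchoose : m.choose t * (q * (n + 1)) ≤ q ^ t := by
    have := choose_mul_le_pow hm0 hw1 hwt hst hKw
    rw [hK] at this
    exact_mod_cast this
  obtain ⟨c, hc, hcol⟩ := exists_columns (F := F) (by omega) htm (by rw [hF]; exact hchoose) n
    n.le_succ
  have hdt : (d : ℝ) * (t - 1 : ℕ) < ε * m := by
    have hts : ((t - 1 : ℕ) : ℝ) ≤ s := by
      have := Nat.ceil_lt_add_one hs0.le
      rw [Nat.cast_sub ht0, Nat.cast_one]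
      linarith
    have hsd : s * (d + 1) = ε * m := by rw [hs]; field_simp
    nlinarith
  obtain ⟨A, hA, hAm, hAI⟩ := exists_dense_of_columns c hc (fun r r' hr => by
    by_contra! hcon
    have hpos : 1 ≤ (Finset.univ.filter fun p : Fin m × Fin m =>
        p.1 ≠ p.2 ∧ ∀ i, c i p.1 = c i p.2).card :=
      Finset.card_pos.2 ⟨(r, r'), by simpa using ⟨hr, hcon⟩⟩
    have h8 : 8 ^ n ≤ (Fintype.card F - 1) ^ n := Nat.pow_le_pow_left (by omega) n
    have hm2 : m ^ 2 ≤ (2 * n ^ 2) ^ 2 := Nat.pow_le_pow_left hmle 2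
    have := two_mul_sq_sq_lt_eight_pow hn10
    have := Nat.le_mul_of_pos_left ((Fintype.card F - 1) ^ n) hpos
    omega) hm0 hdt
  exact ⟨A, hA, hAm.le, hAI⟩
end

section
/- Let q be a prime power, 0 < ε < 1, and d, n positive integers with n > q, n > d, and (d+1)/ε + 1 ≤ q ≤ 4(d+1)/ε. Then there exists a (1−ε)-dense hitting set A for H_d over F_q of size at most m = ⌈4(q−1)²·(d+1)·ln(q(n+1)) / ((q − (d+1)/ε)²·ε)⌉. -/
open Finset

/-- Proportions of binomial coefficients: `C(b, k) / C(N, k) ≤ (b / N) ^ k`. -/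
theorem choose_mul_pow_le_choose_mul_pow {b N : ℕ} (h : b ≤ N) (k : ℕ) :
    b.choose k * N ^ k ≤ N.choose k * b ^ k := by
  have key : ∀ k, b.descFactorial k * N ^ k ≤ N.descFactorial k * b ^ k := by
    intro k
    induction k with
    | zero => simp
    | succ k ih =>
      have h1 : (b - k) * N ≤ (N - k) * b := by
        rw [Nat.sub_mul, Nat.sub_mul, mul_comm N b]
        exact Nat.sub_le_sub_left (Nat.mul_le_mul_left k h) _
      calc b.descFactorial (k + 1) * N ^ (k + 1)
          = ((b - k) * N) * (b.descFactorial k * N ^ k) := by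
            rw [Nat.descFactorial_succ]; ring
        _ ≤ ((N - k) * b) * (N.descFactorial k * b ^ k) := Nat.mul_le_mul h1 ih
        _ = N.descFactorial (k + 1) * b ^ (k + 1) := by
            rw [Nat.descFactorial_succ]; ring
  have := key k
  rw [Nat.descFactorial_eq_factorial_mul_choose, Nat.descFactorial_eq_factorial_mul_choose,
    mul_assoc, mul_assoc] at this
  exact Nat.le_of_mul_le_mul_left this (Nat.factorial_pos k)

/-- The number of `m`-subsets of a finite type containing a given set `T`. -/
theorem card_filter_subset_powersetCard_univ {α : Type*} [Fintype α] [DecidableEq α]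
    (T : Finset α) {m : ℕ} (hT : #T ≤ m) :
    #{S ∈ powersetCard m (univ : Finset α) | T ⊆ S} =
      (Fintype.card α - #T).choose (m - #T) := by
  rw [← card_compl, ← card_powersetCard]
  refine card_nbij' (fun S => S \ T) (fun S => S ∪ T) ?_ ?_ ?_ ?_
  · intro S hS
    simp only [coe_filter, mem_powersetCard, subset_univ, true_and, Set.mem_ofPred_eq] at hS
    simp only [mem_coe, mem_powersetCard]
    refine ⟨fun x hx => ?_, ?_⟩
    · simpa using (mem_sdiff.1 hx).2
    · rw [card_sdiff_of_subset hS.2, hS.1]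
  · intro S hS
    simp only [mem_coe, mem_powersetCard] at hS
    have hd : Disjoint S T := subset_compl_iff_disjoint_right.1 hS.1
    simp only [coe_filter, mem_powersetCard, subset_univ, true_and, Set.mem_ofPred_eq,
      subset_union_right, and_true]
    rw [card_union_of_disjoint hd, hS.2]
    omega
  · intro S hS
    simp only [coe_filter, Set.mem_ofPred_eq] at hS
    exact sdiff_union_of_subset hS.2
  · intro S hS
    simp only [mem_coe, mem_powersetCard] at hS
    exact union_sdiff_cancel_right (subset_compl_iff_disjoint_right.1 hS.1)

/-- The generating function of the hypergeometric distribution is bounded by that of the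
binomial distribution. -/
theorem sum_powersetCard_one_add_pow_card_inter_le {α : Type*} [Fintype α] [DecidableEq α]
    (B : Finset α) {l : ℝ} (hl : 0 ≤ l) (m : ℕ) (hN : 0 < Fintype.card α) :
    ∑ S ∈ powersetCard m (univ : Finset α), (1 + l) ^ #(S ∩ B) ≤
      (Fintype.card α).choose m * (1 + l * (#B / Fintype.card α)) ^ m := by
  set N := Fintype.card α with hNdef
  have expand : ∀ S : Finset α,
      (1 + l) ^ #(S ∩ B) = ∑ T ∈ B.powerset, if T ⊆ S then l ^ #T else 0 := by
    intro S
    have := sum_pow_mul_eq_add_pow l 1 (S ∩ B)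
    rw [add_comm, ← this, ← sum_filter]
    refine sum_congr ?_ (by simp)
    ext T
    rw [mem_powerset, subset_inter_iff, mem_filter, mem_powerset, and_comm]
  have count : ∀ T ∈ B.powerset,
      (∑ S ∈ powersetCard m (univ : Finset α), if T ⊆ S then l ^ #T else 0) =
        if #T ≤ m then l ^ #T * ((N - #T).choose (m - #T) : ℝ) else 0 := by
    intro T _
    rw [← sum_filter, sum_const, nsmul_eq_mul]
    split_ifs with h
    · rw [card_filter_subset_powersetCard_univ T h, mul_comm]
    · rw [filter_eq_empty_iff.2, card_empty, Nat.cast_zero, zero_mul]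
      intro S hS hTS
      exact h ((card_le_card hTS).trans (mem_powersetCard.1 hS).2.le)
  have hB : #B ≤ N := card_le_univ B
  have hN' : (0 : ℝ) < N := by exact_mod_cast hN
  simp_rw [expand]
  rw [sum_comm, sum_congr rfl count,
    sum_powerset_apply_card (fun k => if k ≤ m then l ^ k * ((N - k).choose (m - k) : ℝ) else 0)]
  have term : ∀ k, (#B).choose k •
      (if k ≤ m then l ^ k * ((N - k).choose (m - k) : ℝ) else 0) ≤
        N.choose m * ((l * (#B / N)) ^ k * m.choose k) := by
    intro k
    split_ifs with h
    · have h1 : ((#B).choose k : ℝ) * N ^ k ≤ N.choose k * (#B : ℝ) ^ k := by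
        exact_mod_cast choose_mul_pow_le_choose_mul_pow hB k
      have h2 : (N.choose m : ℝ) * m.choose k = N.choose k * (N - k).choose (m - k) := by
        exact_mod_cast Nat.choose_mul h
      have h3 : ((#B).choose k : ℝ) ≤ N.choose k * (#B / N : ℝ) ^ k := by
        rw [div_pow, ← mul_div_assoc, le_div_iff₀ (by positivity)]
        exact h1
      calc (#B).choose k • (l ^ k * ((N - k).choose (m - k) : ℝ))
          = ((#B).choose k : ℝ) * (l ^ k * ((N - k).choose (m - k) : ℝ)) := nsmul_eq_mul _ _
        _ ≤ (N.choose k * (#B / N : ℝ) ^ k) * (l ^ k * ((N - k).choose (m - k) : ℝ)) := by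
            gcongr
        _ = (N.choose k * (N - k).choose (m - k)) * (l * (#B / N)) ^ k := by
            rw [mul_pow]; ring
        _ = _ := by rw [← h2]; ring
    · rw [smul_zero]
      positivity
  have hle : ∀ k, 0 ≤ (N.choose m : ℝ) * ((l * (#B / N)) ^ k * m.choose k) := fun k => by
    positivity
  calc _ ≤ ∑ k ∈ range (#B + 1), (N.choose m : ℝ) * ((l * (#B / N)) ^ k * m.choose k) :=
        sum_le_sum fun k _ => term k
    _ ≤ ∑ k ∈ range (#B + m + 1), (N.choose m : ℝ) * ((l * (#B / N)) ^ k * m.choose k) :=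
        sum_le_sum_of_subset_of_nonneg (range_subset_range.2 (by omega)) fun k _ _ => hle k
    _ = ∑ k ∈ range (m + 1), (N.choose m : ℝ) * ((l * (#B / N)) ^ k * m.choose k) := by
        symm
        refine sum_subset (range_subset_range.2 (by omega)) fun k _ hk => ?_
        rw [Nat.choose_eq_zero_of_lt (show m < k by simpa using hk)]
        simp
    _ = _ := by
        rw [← mul_sum, add_comm 1, add_pow]
        simp

/-- Second-order Taylor lower bound for `-log (1 - v)`. -/
theorem add_sq_div_two_le_neg_log_one_sub {v : ℝ} (h0 : 0 ≤ v) (h1 : v < 1) :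
    v + v ^ 2 / 2 ≤ -Real.log (1 - v) := by
  have h := Real.hasSum_pow_div_log_of_abs_lt_one (x := v) (by rwa [abs_of_nonneg h0])
  have := sum_le_hasSum (range 2) (fun i _ => by positivity) h
  simpa [sum_range_succ, one_add_one_eq_two] using this

/-- Multiplicative Chernoff bound for the binomial generating function at the optimal point. -/
theorem one_add_mul_pow_le_exp_mul_rpow {p τ : ℝ} (hp : 0 < p) (hpτ : p ≤ τ) (m : ℕ) :
    (1 + (τ / p - 1) * p) ^ m ≤
      Real.exp (-(m * ((τ - p) ^ 2 / (2 * τ)))) * (τ / p) ^ (τ * m) := by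
  have hτ : 0 < τ := hp.trans_le hpτ
  have hlog : (1 - p / τ) + (1 - p / τ) ^ 2 / 2 ≤ Real.log (τ / p) := by
    have h := add_sq_div_two_le_neg_log_one_sub (v := 1 - p / τ)
      (sub_nonneg.2 ((div_le_one hτ).2 hpτ)) (by linarith [div_pos hp hτ])
    rwa [sub_sub_cancel, ← Real.log_inv, inv_div] at h
  have hlog' : (τ - p) + (τ - p) ^ 2 / (2 * τ) ≤ τ * Real.log (τ / p) := by
    refine le_trans (le_of_eq ?_) (mul_le_mul_of_nonneg_left hlog hτ.le)
    field_simp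
  have hbase : 1 + (τ / p - 1) * p ≤ Real.exp (τ - p) := by
    have := Real.add_one_le_exp (τ - p)
    have e : (τ / p - 1) * p = τ - p := by field_simp
    linarith
  have hpos : 0 ≤ 1 + (τ / p - 1) * p := by
    have : 1 ≤ τ / p := (one_le_div hp).2 hpτ
    nlinarith
  calc (1 + (τ / p - 1) * p) ^ m ≤ Real.exp (τ - p) ^ m := by gcongr
    _ = Real.exp (m * (τ - p)) := by rw [← Real.exp_nat_mul]
    _ ≤ Real.exp (-(m * ((τ - p) ^ 2 / (2 * τ))) + Real.log (τ / p) * (τ * m)) := by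
        rw [Real.exp_le_exp]
        nlinarith [mul_le_mul_of_nonneg_left hlog' (Nat.cast_nonneg (α := ℝ) m)]
    _ = _ := by rw [Real.exp_add, Real.rpow_def_of_pos (div_pos hτ hp)]

/-- Chernoff bound for sampling without replacement: the number of `m`-subsets that meet a set
of density at most `p` in at least `τ m` points. -/
theorem card_powersetCard_filter_le_card_inter_le {α : Type*} [Fintype α] [DecidableEq α]
    (B : Finset α) {p τ : ℝ} (hp : 0 < p) (hpτ : p ≤ τ) (m : ℕ) (hN : 0 < Fintype.card α)
    (hB : (#B : ℝ) / Fintype.card α ≤ p) :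
    (#{S ∈ powersetCard m (univ : Finset α) | τ * m ≤ #(S ∩ B)} : ℝ) ≤
      (Fintype.card α).choose m * Real.exp (-(m * ((τ - p) ^ 2 / (2 * τ)))) := by
  have h1 : 1 ≤ τ / p := (one_le_div hp).2 hpτ
  have hpos : 0 < (τ / p) ^ (τ * m) := Real.rpow_pos_of_pos (by linarith) _
  refine le_of_mul_le_mul_right ?_ hpos
  calc (#{S ∈ powersetCard m (univ : Finset α) | τ * m ≤ #(S ∩ B)} : ℝ) * (τ / p) ^ (τ * m)
      = ∑ S ∈ powersetCard m (univ : Finset α) with τ * m ≤ #(S ∩ B), (τ / p) ^ (τ * m) := by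
        rw [sum_const, nsmul_eq_mul]
    _ ≤ ∑ S ∈ powersetCard m (univ : Finset α) with τ * m ≤ #(S ∩ B),
          (1 + (τ / p - 1)) ^ #(S ∩ B) := by
        refine sum_le_sum fun S hS => ?_
        rw [add_sub_cancel, ← Real.rpow_natCast]
        exact Real.rpow_le_rpow_of_exponent_le h1 (mem_filter.1 hS).2
    _ ≤ ∑ S ∈ powersetCard m (univ : Finset α), (1 + (τ / p - 1)) ^ #(S ∩ B) :=
        sum_le_sum_of_subset_of_nonneg (filter_subset _ _) fun S _ _ =>
          pow_nonneg (by linarith) _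
    _ ≤ (Fintype.card α).choose m * (1 + (τ / p - 1) * (#B / Fintype.card α)) ^ m :=
        sum_powersetCard_one_add_pow_card_inter_le B (by linarith) m hN
    _ ≤ (Fintype.card α).choose m * (1 + (τ / p - 1) * p) ^ m := by
        have : 0 ≤ τ / p - 1 := by linarith
        gcongr
    _ ≤ _ := by
        rw [mul_assoc]
        exact mul_le_mul_of_nonneg_left (one_add_mul_pow_le_exp_mul_rpow hp hpτ m)
          (Nat.cast_nonneg _)

/-- A family of fewer than `exp (m (τ - p) ^ 2 / (2 τ))` sets of density at most `p` admits an
`m`-set meeting each of them in fewer than `τ m` points. -/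
theorem exists_card_eq_forall_card_inter_lt {α ι : Type*} [Fintype α] [DecidableEq α]
    (J : Finset ι) (B : ι → Finset α) {p τ : ℝ} (hp : 0 < p) (hpτ : p ≤ τ) {m : ℕ}
    (hm : m ≤ Fintype.card α) (hN : 0 < Fintype.card α)
    (hB : ∀ j ∈ J, (#(B j) : ℝ) / Fintype.card α ≤ p)
    (hJ : (#J : ℝ) * Real.exp (-(m * ((τ - p) ^ 2 / (2 * τ)))) < 1) :
    ∃ S : Finset α, #S = m ∧ ∀ j ∈ J, (#(S ∩ B j) : ℝ) < τ * m := by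
  by_contra! hcon
  have hsub : powersetCard m (univ : Finset α) ⊆
      J.biUnion fun j => {S ∈ powersetCard m (univ : Finset α) | τ * m ≤ #(S ∩ B j)} := by
    intro S hS
    obtain ⟨j, hj, h⟩ := hcon S (mem_powersetCard.1 hS).2
    exact mem_biUnion.2 ⟨j, hj, mem_filter.2 ⟨hS, h⟩⟩
  have hcard := (card_le_card hsub).trans card_biUnion_le
  rw [card_powersetCard, card_univ] at hcard
  have hchoose : (0 : ℝ) < (Fintype.card α).choose m := by exact_mod_cast Nat.choose_pos hm
  have : ((Fintype.card α).choose m : ℝ) ≤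
      (Fintype.card α).choose m * (#J * Real.exp (-(m * ((τ - p) ^ 2 / (2 * τ))))) := by
    calc ((Fintype.card α).choose m : ℝ)
        ≤ ∑ j ∈ J, (#{S ∈ powersetCard m (univ : Finset α) | τ * m ≤ #(S ∩ B j)} : ℝ) := by
          exact_mod_cast hcard
      _ ≤ ∑ j ∈ J, ((Fintype.card α).choose m : ℝ) *
            Real.exp (-(m * ((τ - p) ^ 2 / (2 * τ)))) :=
          sum_le_sum fun j hj =>
            card_powersetCard_filter_le_card_inter_le (B j) hp hpτ m hN (hB j hj)
      _ = _ := by rw [sum_const, nsmul_eq_mul]; ring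
  nlinarith

/-- Two distinct coordinates agree on a `1 / |F|` proportion of `ι → F`. -/
theorem card_filter_apply_eq_apply_mul_card {ι F : Type*} [Fintype ι] [DecidableEq ι]
    [AddCommGroup F] [Fintype F] [DecidableEq F] {i j : ι} (hij : i ≠ j) :
    #{a : ι → F | a i = a j} * Fintype.card F = Fintype.card (ι → F) := by
  have h := card_eq_sum_card_fiberwise (s := (univ : Finset (ι → F))) (t := (univ : Finset F))
    (f := fun a => a i - a j) fun _ _ => mem_coe.2 (mem_univ _)
  rw [← card_univ (α := ι → F), h, sum_congr rfl (g := fun _ => #{a : ι → F | a i = a j}),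
    sum_const, card_univ, smul_eq_mul, mul_comm]
  intro c _
  refine card_nbij' (fun a => a - Pi.single i c) (fun a => a + Pi.single i c) ?_ ?_ ?_ ?_
  · intro a ha
    simp only [coe_filter, mem_univ, true_and, Set.mem_ofPred_eq] at ha ⊢
    simp [hij.symm, ← ha]
  · intro a ha
    simp only [coe_filter, mem_univ, true_and, Set.mem_ofPred_eq] at ha ⊢
    simp [hij.symm, ha]
  · intro a _
    simp
  · intro a _
    simp

/-- If any two distinct coordinates agree on less than an `ε / d` fraction of `A`, then `A` is
`(1 - ε)`-dense for products of at most `d` differences of coordinates. -/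
theorem mul_card_lt_card_filter_forall_ne {ι F : Type*} [DecidableEq F]
    {A : Finset (ι → F)} (hA : A.Nonempty) {d : ℕ} (hd : 0 < d) {ε : ℝ} (hε : 0 < ε)
    (h : ∀ i j, i ≠ j → (#{a ∈ A | a i = a j} : ℝ) < ε / d * #A)
    (I : Finset (ι × ι)) (hI : #I ≤ d) (hne : ∀ p ∈ I, p.1 ≠ p.2) :
    (1 - ε) * #A < (#{a ∈ A | ∀ p ∈ I, a p.1 ≠ a p.2} : ℝ) := by
  classical
  have hA' : (0 : ℝ) < #A := by exact_mod_cast hA.card_pos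
  have hd' : (0 : ℝ) < d := by exact_mod_cast hd
  have hsplit := card_filter_add_card_filter_not (s := A) (fun a => ∀ p ∈ I, a p.1 ≠ a p.2)
  have hbad : #{a ∈ A | ¬ ∀ p ∈ I, a p.1 ≠ a p.2} ≤ ∑ p ∈ I, #{a ∈ A | a p.1 = a p.2} := by
    refine le_trans (card_le_card fun a ha => ?_) card_biUnion_le
    rw [mem_filter] at ha
    push Not at ha
    obtain ⟨haA, p, hp, hap⟩ := ha
    exact mem_biUnion.2 ⟨p, hp, mem_filter.2 ⟨haA, hap⟩⟩
  have hsum : ∑ p ∈ I, (#{a ∈ A | a p.1 = a p.2} : ℝ) < ε * #A := by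
    rcases I.eq_empty_or_nonempty with rfl | hIne
    · simpa using mul_pos hε hA'
    calc ∑ p ∈ I, (#{a ∈ A | a p.1 = a p.2} : ℝ) < ∑ p ∈ I, ε / d * #A :=
          sum_lt_sum_of_nonempty hIne fun p hp => h _ _ (hne p hp)
      _ = #I * (ε / d * #A) := by rw [sum_const, nsmul_eq_mul]
      _ ≤ d * (ε / d * #A) := by gcongr
      _ = ε * #A := by field_simp
  have hsplit' : (#{a ∈ A | ∀ p ∈ I, a p.1 ≠ a p.2} : ℝ) +
      #{a ∈ A | ¬ ∀ p ∈ I, a p.1 ≠ a p.2} = #A := by exact_mod_cast hsplit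
  have hbad' : (#{a ∈ A | ¬ ∀ p ∈ I, a p.1 ≠ a p.2} : ℝ) ≤
      ∑ p ∈ I, (#{a ∈ A | a p.1 = a p.2} : ℝ) := by exact_mod_cast hbad
  linarith

/-- The comparison of Chernoff exponents at `t` and at `t (1 + y)`. -/
theorem sub_sq_mul_one_add_le {p t y : ℝ} (hp : 0 < p) (hpt : p < t) (ht : t ≤ 1 / 2)
    (hy : t ≤ y) :
    (t - p) ^ 2 * (1 + y) ≤ (1 - p) ^ 2 * (t * (1 + y) - p) ^ 2 := by
  have hcoef : 0 ≤ t / 2 + p / 2 - t * p := by nlinarith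
  have hlin : (t - p) * (1 + y / 2) ≤ (1 - p) * (t * (1 + y) - p) := by
    nlinarith [mul_le_mul_of_nonneg_left hy hcoef, sq_nonneg (p - t / 2), sq_nonneg t,
      mul_nonneg (mul_nonneg (hp.trans hpt).le hp.le) (sub_nonneg.2 ht)]
  calc (t - p) ^ 2 * (1 + y) ≤ ((t - p) * (1 + y / 2)) ^ 2 := by
        rw [mul_pow]
        exact mul_le_mul_of_nonneg_left (by nlinarith [sq_nonneg y]) (sq_nonneg _)
    _ ≤ ((1 - p) * (t * (1 + y) - p)) ^ 2 :=
        pow_le_pow_left₀ (mul_nonneg (by linarith) (by linarith)) hlin 2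
    _ = _ := mul_pow _ _ _

/-- The sample size of the main theorem makes the Chernoff exponent at least
`2 * log (q * (n + 1))`. -/
theorem two_mul_le_sample_size_mul {q d ε L : ℝ} (hd : 1 ≤ d) (hε0 : 0 < ε) (hε1 : ε < 1)
    (hL : 0 ≤ L) (hq : (d + 1) / ε + 1 ≤ q) :
    2 * L ≤ 4 * (q - 1) ^ 2 * (d + 1) * L / ((q - (d + 1) / ε) ^ 2 * ε) *
      ((ε / d - 1 / q) ^ 2 / (2 * (ε / d))) := by
  have hd0 : 0 < d := by linarith
  have hd1 : 0 < d + 1 := by linarith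
  have hr : 0 < (d + 1) / ε := by positivity
  have hq0 : 0 < q := by linarith
  have hgap : 0 < q - (d + 1) / ε := by linarith
  have hp : 0 < 1 / q := by positivity
  have hpt : 1 / q < ε / (d + 1) := by
    rw [div_lt_div_iff₀ hq0 hd1, one_mul, ← div_lt_iff₀' hε0]
    linarith
  have ht : ε / (d + 1) ≤ 1 / 2 := by
    rw [div_le_div_iff₀ hd1 two_pos]; linarith
  have hy : ε / (d + 1) ≤ 1 / d := by
    rw [div_le_div_iff₀ hd1 hd0]; nlinarith
  have key := sub_sq_mul_one_add_le hp hpt ht hy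
  have e1 : ε / (d + 1) * (1 + 1 / d) = ε / d := by field_simp
  rw [e1] at key
  have e2 : ε / (d + 1) - 1 / q = ε / ((d + 1) * q) * (q - (d + 1) / ε) := by field_simp
  have e3 : 1 - 1 / q = (q - 1) / q := by field_simp
  rw [e2, e3] at key
  set g := q - (d + 1) / ε with hg
  set s := ε / d - 1 / q with hs
  have key2 : g ^ 2 * ε ^ 2 ≤ (q - 1) ^ 2 * s ^ 2 * ((d + 1) * d) := by
    have h := mul_le_mul_of_nonneg_right key (show 0 ≤ q ^ 2 * (d + 1) * d by positivity)
    have h1 : (ε / ((d + 1) * q) * g) ^ 2 * (1 + 1 / d) * (q ^ 2 * (d + 1) * d) =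
      g ^ 2 * ε ^ 2 := by field_simp
    have h2 : ((q - 1) / q) ^ 2 * s ^ 2 * (q ^ 2 * (d + 1) * d) =
      (q - 1) ^ 2 * s ^ 2 * ((d + 1) * d) := by field_simp
    rwa [h1, h2] at h
  have e4 : 4 * (q - 1) ^ 2 * (d + 1) * L / (g ^ 2 * ε) * (s ^ 2 / (2 * (ε / d))) =
      2 * L * ((q - 1) ^ 2 * s ^ 2 * ((d + 1) * d)) / (g ^ 2 * ε ^ 2) := by
    field_simp; ring
  rw [e4, le_div_iff₀ (by positivity)]
  exact mul_le_mul_of_nonneg_left key2 (by positivity)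


/-- Let `q` be a prime power, `0 < ε < 1`, and `d, n` positive integers with `n > q`,
`n > d` and `(d+1)/ε + 1 ≤ q ≤ 4(d+1)/ε`.  Then there exists a `(1−ε)`-dense hitting
set `A` for `H_d` over `F_q` of size at most
`⌈4(q−1)²·(d+1)·ln(q(n+1)) / ((q − (d+1)/ε)²·ε)⌉`: a finite nonempty set `A ⊆ F_q^n`
such that for every `I ⊆ [n]×[n]` with `|I| ≤ d` and `i₁ ≠ i₂` for every
`(i₁,i₂) ∈ I`, the fraction of `a ∈ A` with `a_{i₁} ≠ a_{i₂}` for all `(i₁,i₂) ∈ I` is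
greater than `1 − ε`. -/
theorem exists_dense_hitting_set_small_q (q d n : ℕ) (hq : IsPrimePow q) (ε : ℝ)
    (hε0 : 0 < ε) (hε1 : ε < 1)
    (hd : 0 < d) (hn : 0 < n) (hnq : n > q) (hnd : n > d)
    (hq1 : ((d : ℝ) + 1) / ε + 1 ≤ (q : ℝ)) (hq2 : (q : ℝ) ≤ 4 * ((d : ℝ) + 1) / ε)
    (F : Type) [Field F] [Fintype F] [DecidableEq F] (hF : Fintype.card F = q) :
    ∃ A : Finset (Fin n → F),
      A.Nonempty ∧
      A.card ≤
        ⌈4 * ((q : ℝ) - 1) ^ 2 * ((d : ℝ) + 1) * Real.log (q * (n + 1)) /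
          (((q : ℝ) - ((d : ℝ) + 1) / ε) ^ 2 * ε)⌉₊ ∧
      ∀ I : Finset (Fin n × Fin n), I.card ≤ d → (∀ p ∈ I, p.1 ≠ p.2) →
        (1 - ε) * A.card < ((A.filter fun a => ∀ p ∈ I, a p.1 ≠ a p.2).card : ℝ) := by
  have hd' : (1 : ℝ) ≤ d := by exact_mod_cast hd
  have hd0 : (0 : ℝ) < d := by linarith
  have hr : 0 < ((d : ℝ) + 1) / ε := by positivity
  have hq0 : (0 : ℝ) < q := by linarith
  have hq1' : (1 : ℝ) < q := by linarith
  have hn' : (1 : ℝ) ≤ n := by exact_mod_cast hn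
  have hL : 0 < Real.log (q * (n + 1)) := Real.log_pos (by nlinarith)
  have hgap : 0 < (q : ℝ) - ((d : ℝ) + 1) / ε := by linarith
  have hpτ : 1 / (q : ℝ) < ε / d := by
    have h : (d : ℝ) / ε ≤ ((d : ℝ) + 1) / ε := by gcongr; linarith
    rw [div_lt_div_iff₀ hq0 hd0, one_mul, ← div_lt_iff₀' hε0]
    linarith
  have hexp := two_mul_le_sample_size_mul hd' hε0 hε1 hL.le hq1
  set M := 4 * ((q : ℝ) - 1) ^ 2 * ((d : ℝ) + 1) * Real.log (q * (n + 1)) /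
    (((q : ℝ) - ((d : ℝ) + 1) / ε) ^ 2 * ε) with hM
  have hM0 : 0 < M := by
    have : 0 < (q : ℝ) - 1 := by linarith
    positivity
  have hN : 0 < Fintype.card (Fin n → F) := Fintype.card_pos
  have hB : ∀ i j : Fin n, i ≠ j →
      (#{a : Fin n → F | a i = a j} : ℝ) / Fintype.card (Fin n → F) = 1 / q := by
    intro i j hij
    have h : (#{a : Fin n → F | a i = a j} : ℝ) * q = Fintype.card (Fin n → F) := by
      rw [← hF]
      exact_mod_cast card_filter_apply_eq_apply_mul_card hij
    rw [div_eq_div_iff (by positivity) hq0.ne', h, one_mul]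
  obtain ⟨A, hA, hAM, hagree⟩ : ∃ A : Finset (Fin n → F), A.Nonempty ∧ #A ≤ ⌈M⌉₊ ∧
      ∀ i j, i ≠ j → (#{a ∈ A | a i = a j} : ℝ) < ε / d * #A := by
    rcases le_or_gt ⌈M⌉₊ (Fintype.card (Fin n → F)) with hm | hm
    · obtain ⟨A, hA, h⟩ := exists_card_eq_forall_card_inter_lt
        ({p : Fin n × Fin n | p.1 ≠ p.2} : Finset (Fin n × Fin n))
        (fun p => ({a : Fin n → F | a p.1 = a p.2} : Finset (Fin n → F)))
        (p := 1 / (q : ℝ)) (by positivity) hpτ.le hm hN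
        (fun p hp => (hB p.1 p.2 (mem_filter.1 hp).2).le) (by
          have hc : (#({p : Fin n × Fin n | p.1 ≠ p.2} : Finset (Fin n × Fin n)) : ℝ) ≤
              (n : ℝ) ^ 2 := by
            have := card_le_univ ({p : Fin n × Fin n | p.1 ≠ p.2} : Finset (Fin n × Fin n))
            rw [Fintype.card_prod, Fintype.card_fin, ← sq] at this
            exact_mod_cast this
          have hx : 2 * Real.log (q * (n + 1)) ≤
              ⌈M⌉₊ * ((ε / d - 1 / q) ^ 2 / (2 * (ε / d))) :=
            hexp.trans (mul_le_mul_of_nonneg_right (Nat.le_ceil M) (by positivity))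
          have hlog : 2 * Real.log n < 2 * Real.log (q * (n + 1)) := by
            have := Real.log_lt_log (show (0 : ℝ) < n by linarith)
              (show (n : ℝ) < q * (n + 1) by nlinarith)
            linarith
          calc _ ≤ (n : ℝ) ^ 2 *
                Real.exp (-(⌈M⌉₊ * ((ε / d - 1 / q) ^ 2 / (2 * (ε / d))))) := by gcongr
            _ < (n : ℝ) ^ 2 * Real.exp (-(2 * Real.log n)) := by
                have := hlog.trans_le hx
                gcongr
            _ = 1 := by
                rw [Real.exp_neg, two_mul, Real.exp_add, Real.exp_log (by linarith)]
                field_simp)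
      refine ⟨A, card_pos.1 (hA ▸ Nat.ceil_pos.2 hM0), hA.le, fun i j hij => ?_⟩
      have := h (i, j) (by simpa using hij)
      rwa [inter_filter, inter_univ, ← hA] at this
    · refine ⟨univ, univ_nonempty, (card_univ (α := Fin n → F)).trans_le hm.le,
        fun i j hij => ?_⟩
      rw [card_univ, ← div_lt_iff₀ (by exact_mod_cast hN), hB i j hij]
      exact hpτ
  refine ⟨A, hA, hAM, fun I hI hne => ?_⟩
  convert mul_card_lt_card_filter_forall_ne hA hd hε0 hagree I hI hne
end
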